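/- arXiv:math/0703876 — 3 statements merged into one kernel-verified Lean document; each statement's English description precedes it below -/
import Mathlib

section
/- Let G be a group acting by automorphisms on a finite nilpotent group A in such a way that the induced action of G on the Frattini factor A/Φ(A) is nilpotent. Then the action of G on A is also nilpotent. -/
/-- The `G`-commutator subgroups of a `G`-group `A`:
`Γ_G^0(A) = A` and `Γ_G^{n+1}(A)` is generated by `{(g • a)⁻¹ * a : g ∈ G, a ∈ Γ_G^n(A)}`. -/
def gammaG (G A : Type*) [Group G] [Group A] [MulDistribMulAction G A] : ℕ → Subgroup A
  | 0 => ⊤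
  | n + 1 => Subgroup.closure {x : A | ∃ (g : G) (a : A), a ∈ gammaG G A n ∧ x = (g • a)⁻¹ * a}

section GCommutator

variable {G A B : Type*} [Group G] [Group A] [Group B]
  [MulDistribMulAction G A] [MulDistribMulAction G B]

theorem smul_inv_mul_mem_gammaG_succ {n : ℕ} {a : A} (ha : a ∈ gammaG G A n) (g : G) :
    (g • a)⁻¹ * a ∈ gammaG G A (n + 1) :=
  Subgroup.subset_closure ⟨g, a, ha, rfl⟩

theorem gammaG_succ_le_iff {n : ℕ} {H : Subgroup A} :
    gammaG G A (n + 1) ≤ H ↔ ∀ (g : G), ∀ a ∈ gammaG G A n, (g • a)⁻¹ * a ∈ H := by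
  rw [gammaG, Subgroup.closure_le]
  constructor
  · intro h g a ha
    exact h ⟨g, a, ha, rfl⟩
  · rintro h _ ⟨g, a, ha, rfl⟩
    exact h g a ha

theorem smul_mem_gammaG (n : ℕ) (g : G) {a : A} (ha : a ∈ gammaG G A n) :
    g • a ∈ gammaG G A n := by
  induction n generalizing g a with
  | zero => exact Subgroup.mem_top _
  | succ n ih =>
    have h : gammaG G A (n + 1) ≤
        (gammaG G A (n + 1)).comap (MulDistribMulAction.toMonoidHom A g) := by
      rw [gammaG_succ_le_iff]
      intro k b hb
      have := smul_inv_mul_mem_gammaG_succ (ih g hb) (g * k * g⁻¹)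
      simpa [mul_smul, smul_mul', smul_inv'] using this
    exact h ha

theorem gammaG_antitone : Antitone (gammaG G A) :=
  antitone_nat_of_succ_le fun n => gammaG_succ_le_iff.2 fun g _ ha =>
    mul_mem (inv_mem (smul_mem_gammaG n g ha)) ha

theorem map_gammaG_le (f : A →* B) (hf : ∀ (g : G) (a : A), f (g • a) = g • f a) (n : ℕ) :
    (gammaG G A n).map f ≤ gammaG G B n := by
  induction n with
  | zero => exact le_top
  | succ n ih =>
    rw [Subgroup.map_le_iff_le_comap, gammaG_succ_le_iff]
    intro g a ha
    have := smul_inv_mul_mem_gammaG_succ (ih (Subgroup.mem_map_of_mem f ha)) g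
    simpa [hf] using this

theorem gammaG_le_map (f : A →* B) (hf : ∀ (g : G) (a : A), f (g • a) = g • f a)
    (hs : Function.Surjective f) (n : ℕ) :
    gammaG G B n ≤ (gammaG G A n).map f := by
  induction n with
  | zero => intro b _; obtain ⟨a, rfl⟩ := hs b; exact ⟨a, Subgroup.mem_top _, rfl⟩
  | succ n ih =>
    rw [gammaG_succ_le_iff]
    intro g b hb
    obtain ⟨a, ha, rfl⟩ := ih hb
    exact ⟨_, smul_inv_mul_mem_gammaG_succ ha g, by simp [hf]⟩

/-- The elements of `A` fixed by `g`. -/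
def fixedBySubgroup (A : Type*) [Group A] [MulDistribMulAction G A] (g : G) : Subgroup A :=
  (MulDistribMulAction.toMonoidHom A g).eqLocus (MonoidHom.id A)

theorem mem_fixedBySubgroup {g : G} {a : A} : a ∈ fixedBySubgroup A g ↔ g • a = a := Iff.rfl

/-- An element acting with prime order `q` not dividing `|A|` has a fixed point in each
coset of `Γ^{n+1}` contained in `Γ^n`. -/
theorem gammaG_le_fixedBySubgroup_sup_succ [Finite A] {q : ℕ} [Fact q.Prime]
    (hq : ¬ q ∣ Nat.card A) {g : G} (hg : ∀ a : A, g ^ q • a = a) (n : ℕ) :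
    gammaG G A n ≤ fixedBySubgroup A g ⊔ gammaG G A (n + 1) := by
  intro a ha
  let σ : Equiv.Perm A :=
    ((Equiv.mulLeft a).trans (MulAction.toPerm g)).trans (Equiv.mulLeft a).symm
  have hσ (x : A) : σ x = a⁻¹ * g • (a * x) := rfl
  have hmem (x : A) (hx : x ∈ gammaG G A (n + 1)) : σ x ∈ gammaG G A (n + 1) := by
    rw [hσ, smul_mul', ← mul_assoc]
    refine mul_mem ?_ (smul_mem_gammaG _ g hx)
    simpa using inv_mem (smul_inv_mul_mem_gammaG_succ ha g)
  have hpow (k : ℕ) (x : A) : (σ ^ k) x = a⁻¹ * g ^ k • (a * x) := by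
    induction k with
    | zero => simp
    | succ k ih => rw [pow_succ', Equiv.Perm.mul_apply, ih, hσ, pow_succ', mul_smul]; simp
  let τ : Equiv.Perm (gammaG G A (n + 1)) :=
    Equiv.ofBijective (fun x => ⟨σ x, hmem x x.2⟩) <| Finite.injective_iff_bijective.1
      fun x y h => Subtype.ext (σ.injective (congrArg Subtype.val h))
  have hτ (k : ℕ) (x : gammaG G A (n + 1)) : ((τ ^ k) x : A) = (σ ^ k) x := by
    induction k with
    | zero => rfl
    | succ k ih =>
      rw [pow_succ', pow_succ', Equiv.Perm.mul_apply, Equiv.Perm.mul_apply, ← ih]; rfl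
  have hτq : τ ^ q ^ 1 = 1 := by
    ext x
    rw [pow_one, hτ, hpow, hg]
    simp
  have := Fintype.ofFinite (gammaG G A (n + 1))
  obtain ⟨x, hx⟩ := Equiv.Perm.exists_fixed_point_of_prime (n := 1) (p := q)
    (fun h => hq ((Nat.card_eq_fintype_card (α := gammaG G A (n + 1)) ▸ h).trans
      (Subgroup.card_subgroup_dvd_card _))) hτq
  have hx' : a⁻¹ * g • (a * x) = (x : A) := congrArg Subtype.val hx
  have hfix : a * x ∈ fixedBySubgroup A g :=
    mem_fixedBySubgroup.2 (inv_mul_eq_iff_eq_mul.1 hx')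
  simpa using mul_mem (Subgroup.mem_sup_left (T := gammaG G A (n + 1)) hfix)
    (Subgroup.mem_sup_right (S := fixedBySubgroup A g) (inv_mem x.2))

theorem fixedBySubgroup_sup_gammaG_eq_top [Finite A] {q : ℕ} [Fact q.Prime]
    (hq : ¬ q ∣ Nat.card A) {g : G} (hg : ∀ a : A, g ^ q • a = a) (n : ℕ) :
    fixedBySubgroup A g ⊔ gammaG G A n = ⊤ := by
  induction n with
  | zero => exact sup_top_eq _
  | succ n ih =>
    exact top_le_iff.1 (ih ▸ sup_le le_sup_left (gammaG_le_fixedBySubgroup_sup_succ hq hg n))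

theorem isPGroup_range_toMulAut_of_gammaG_le_frattini [Finite A] {p : ℕ} [Fact p.Prime]
    (hA : IsPGroup p A) {r : ℕ} (hr : gammaG G A r ≤ frattini A) :
    IsPGroup p (MulDistribMulAction.toMulAut G A).range := by
  have : Finite (MulAut A) := Finite.of_injective (fun e : MulAut A => (e : A → A))
    DFunLike.coe_injective
  refine IsPGroup.of_card (n := _) (Nat.eq_prime_pow_of_unique_prime_dvd Nat.card_pos.ne' ?_)
  intro q hqp hqd
  have : Fact q.Prime := ⟨hqp⟩
  by_contra hne
  obtain ⟨⟨_, g, rfl⟩, hx⟩ := exists_prime_orderOf_dvd_card' q hqd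
  replace hx := (Subgroup.orderOf_coe _).trans hx
  change orderOf (MulDistribMulAction.toMulAut G A g) = q at hx
  have hg (a : A) : g ^ q • a = a := by
    have h := pow_orderOf_eq_one (MulDistribMulAction.toMulAut G A g)
    rw [hx, ← map_pow] at h
    exact DFunLike.congr_fun h a
  have hq : ¬ q ∣ Nat.card A := by
    obtain ⟨k, hk⟩ := IsPGroup.iff_card.1 hA
    rw [hk]
    exact fun h => hne ((Nat.prime_dvd_prime_iff_eq hqp Fact.out).1 (hqp.dvd_of_dvd_pow h))
  have htop : fixedBySubgroup A g = ⊤ := frattini_nongenerating <|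
    top_le_iff.1 (fixedBySubgroup_sup_gammaG_eq_top hq hg r ▸ sup_le_sup_left hr _)
  have hone : MulDistribMulAction.toMulAut G A g = 1 := by
    ext a
    exact mem_fixedBySubgroup.1 (htop ▸ Subgroup.mem_top a)
  rw [hone, orderOf_one] at hx
  exact hqp.one_lt.ne hx

theorem map_inl_gammaG_le_lowerCentralSeries (n : ℕ) :
    (gammaG G A n).map (SemidirectProduct.inl
      (φ := (MulDistribMulAction.toMulAut G A).range.subtype)) ≤
    Subgroup.lowerCentralSeries ⊤ n := by
  induction n with
  | zero => exact le_top
  | succ n ih =>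
    rw [Subgroup.map_le_iff_le_comap, gammaG_succ_le_iff]
    intro g a ha
    rw [Subgroup.lowerCentralSeries_succ, Subgroup.commutator_comm]
    have h := Subgroup.commutator_mem_commutator
      (Subgroup.mem_top (SemidirectProduct.inr
        (φ := (MulDistribMulAction.toMulAut G A).range.subtype)
        ((MulDistribMulAction.toMulAut G A).rangeRestrict g)))
      (inv_mem (ih (Subgroup.mem_map_of_mem _ ha)))
    rw [commutatorElement_def, inv_inv, ← map_inv, ← map_inv, ← SemidirectProduct.inl_aut,
      ← map_mul] at h
    rw [← smul_inv']
    exact h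

theorem exists_gammaG_eq_bot_of_isPGroup [Finite A] {p : ℕ} [Fact p.Prime]
    (hA : IsPGroup p A) {r : ℕ} (hr : gammaG G A r ≤ frattini A) :
    ∃ s, gammaG G A s = ⊥ := by
  have : Finite (MulAut A) := Finite.of_injective (fun e : MulAut A => (e : A → A))
    DFunLike.coe_injective
  let φ := (MulDistribMulAction.toMulAut G A).range.subtype
  have hP : IsPGroup p (A ⋊[φ] (MulDistribMulAction.toMulAut G A).range) := by
    obtain ⟨k, hk⟩ := IsPGroup.iff_card.1 hA
    obtain ⟨l, hl⟩ := IsPGroup.iff_card.1 (isPGroup_range_toMulAut_of_gammaG_le_frattini hA hr)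
    refine IsPGroup.of_card (n := k + l) ?_
    rw [SemidirectProduct.card, hk, hl, pow_add]
  have : Finite (A ⋊[φ] (MulDistribMulAction.toMulAut G A).range) :=
    Finite.of_equiv _ SemidirectProduct.equivProd.symm
  obtain ⟨s, hs⟩ := Subgroup.nilpotent_iff_lowerCentralSeries.1 hP.isNilpotent
  refine ⟨s, (Subgroup.map_eq_bot_iff_of_injective _
    (SemidirectProduct.inl_injective (φ := φ))).1 ?_⟩
  exact le_bot_iff.1 (hs ▸ map_inl_gammaG_le_lowerCentralSeries s)

/-- The action induced on the quotient by a characteristic subgroup. -/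
@[reducible]
def quotientMulDistribMulAction (G : Type*) [Group G] [MulDistribMulAction G A]
    (K : Subgroup A) [K.Characteristic] : MulDistribMulAction G (A ⧸ K) where
  smul g := QuotientGroup.map K K (MulDistribMulAction.toMonoidHom A g)
    (Subgroup.characteristic_iff_le_comap.1 ‹_› (MulDistribMulAction.toMulEquiv A g))
  one_smul x := by
    induction x using QuotientGroup.induction_on with
    | H a => exact congrArg QuotientGroup.mk (one_smul G a)
  mul_smul g h x := by
    induction x using QuotientGroup.induction_on with
    | H a => exact congrArg QuotientGroup.mk (mul_smul g h a)
  smul_mul g x y := map_mul _ x y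
  smul_one g := map_one _

end GCommutator

section PResidual

variable {A : Type*} [Group A]

/-- The subgroup generated by the elements of order prime to `p`. -/
def pResidual (p : ℕ) (A : Type*) [Group A] : Subgroup A :=
  Subgroup.closure {x | (orderOf x).Coprime p}

instance (p : ℕ) : (pResidual p A).Characteristic := by
  rw [Subgroup.characteristic_iff_map_le]
  intro e
  rw [pResidual, MonoidHom.map_closure, Subgroup.closure_le]
  rintro _ ⟨x, hx, rfl⟩
  refine Subgroup.subset_closure ?_
  change (orderOf (e x)).Coprime p
  rwa [MulEquiv.orderOf_eq]

theorem isPGroup_quotient_pResidual [Finite A] (p : ℕ) [hp : Fact p.Prime] :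
    IsPGroup p (A ⧸ pResidual p A) := by
  intro x
  induction x using QuotientGroup.induction_on with
  | H a =>
    obtain ⟨k, m, hm, hk⟩ :=
      Nat.exists_eq_pow_mul_and_not_dvd (orderOf_pos a).ne' p hp.out.ne_one
    refine ⟨k, (QuotientGroup.eq_one_iff (a ^ p ^ k)).2 (Subgroup.subset_closure ?_)⟩
    change (orderOf (a ^ p ^ k)).Coprime p
    rw [orderOf_pow_of_dvd (pow_ne_zero _ hp.out.ne_zero) (hk ▸ dvd_mul_right _ _), hk,
      Nat.mul_div_cancel_left _ (pow_pos hp.out.pos k)]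
    exact ((Nat.Prime.coprime_iff_not_dvd hp.out).2 hm).symm

theorem pResidual_le_ker {B : Type*} [Group B] {p : ℕ} [Fact p.Prime] (hB : IsPGroup p B)
    (f : A →* B) : pResidual p A ≤ f.ker := by
  rw [pResidual, Subgroup.closure_le]
  intro x hx
  obtain ⟨k, hk⟩ := hB (f x)
  have h : orderOf (f x) ∣ 1 :=
    (Nat.Coprime.pow_right k hx) ▸
      Nat.dvd_gcd (orderOf_map_dvd f x) (orderOf_dvd_of_pow_eq_one hk)
  exact orderOf_eq_one_iff.1 (Nat.dvd_one.1 h)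

theorem iInf_pResidual_eq_bot [Finite A] [Group.IsNilpotent A] :
    ⨅ p : (Nat.card A).primeFactors, pResidual p A = ⊥ := by
  obtain ⟨e⟩ := ((Group.isNilpotent_of_finite_tfae (G := A)).out 0 4).1 ‹_›
  rw [eq_bot_iff]
  intro x hx
  rw [Subgroup.mem_iInf] at hx
  rw [Subgroup.mem_bot, ← map_eq_one_iff e.symm e.symm.injective]
  funext p P
  have : Fact (p : ℕ).Prime := ⟨Nat.prime_of_mem_primeFactors p.2⟩
  exact pResidual_le_ker P.isPGroup'
    (((Pi.evalMonoidHom _ P).comp (Pi.evalMonoidHom _ p)).comp e.symm.toMonoidHom) (hx p)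

end PResidual

/-- If a group `G` acts by automorphisms on a finite nilpotent group `A`
and the induced action on the Frattini factor `A ⧸ Φ(A)` (i.e. the action compatible with the
quotient map) is nilpotent, then the `G`-action on `A` itself is nilpotent. -/
theorem nilpotent_action_of_nilpotent_action_on_frattini_factor
    {G A : Type*} [Group G] [Group A] [Finite A] [Group.IsNilpotent A]
    [MulDistribMulAction G A]
    [instQ : MulDistribMulAction G (A ⧸ frattini A)]
    (hcomp : ∀ (g : G) (a : A),
      g • (QuotientGroup.mk a : A ⧸ frattini A) = QuotientGroup.mk (g • a))
    (hnilQ : ∃ r, gammaG G (A ⧸ frattini A) r = ⊥) :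
    ∃ r, gammaG G A r = ⊥ := by
  obtain ⟨r, hr⟩ := hnilQ
  have hΦ : gammaG G A r ≤ frattini A := by
    have h := map_gammaG_le (QuotientGroup.mk' (frattini A)) (fun g a => (hcomp g a).symm) r
    rwa [hr, le_bot_iff, Subgroup.map_eq_bot_iff, QuotientGroup.ker_mk'] at h
  have hp (p : (Nat.card A).primeFactors) : ∃ s, gammaG G A s ≤ pResidual p A := by
    have : Fact (p : ℕ).Prime := ⟨Nat.prime_of_mem_primeFactors p.2⟩
    let _ := quotientMulDistribMulAction G (pResidual p A)
    let π := QuotientGroup.mk' (pResidual (p : ℕ) A)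
    have hπ : ∀ (g : G) (a : A), π (g • a) = g • π a := fun _ _ => rfl
    have hs : Function.Surjective π := QuotientGroup.mk'_surjective _
    obtain ⟨s, h⟩ := exists_gammaG_eq_bot_of_isPGroup (G := G) (isPGroup_quotient_pResidual p)
      ((gammaG_le_map π hπ hs r).trans (Subgroup.map_le_iff_le_comap.2
        (hΦ.trans (frattini_le_comap_frattini_of_surjective hs))))
    refine ⟨s, ?_⟩
    have h' := map_gammaG_le π hπ s
    rwa [h, le_bot_iff, Subgroup.map_eq_bot_iff, QuotientGroup.ker_mk'] at h'
  choose s hs using hp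
  refine ⟨Finset.univ.sup s, le_bot_iff.1 (iInf_pResidual_eq_bot (A := A) ▸ le_iInf fun p => ?_)⟩
  exact (gammaG_antitone (Finset.le_sup (Finset.mem_univ p))).trans (hs p)
end

section
/- Let p be a prime and let G be a group acting by automorphisms on an abelian p-group A of exponent dividing pⁿ. If G acts nilpotently on A/pA with nilpotency order r (i.e., Γ_G^r(A/pA) = 0), then G acts nilpotently on A with Γ_G^{n·r}(A) = 0; in particular nil_G A ≤ n · nil_G(A/pA). -/
/-- The `G`-commutator subgroups of a `G`-group `A` (additive notation):
`Γ_G^0(A) = A` and `Γ_G^{n+1}(A)` is generated by `{a - g • a : g ∈ G, a ∈ Γ_G^n(A)}`. -/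
def gammaA (G A : Type*) [Group G] [AddCommGroup A] [DistribMulAction G A] : ℕ → AddSubgroup A
  | 0 => ⊤
  | n + 1 => AddSubgroup.closure {x : A | ∃ (g : G) (a : A), a ∈ gammaA G A n ∧ x = a - g • a}

/-- The subgroup `pA = {p • a : a ∈ A}` of an abelian group `A`. -/
def pMul (p : ℕ) (A : Type*) [AddCommGroup A] : AddSubgroup A where
  carrier := {x : A | ∃ a : A, x = p • a}
  zero_mem' := ⟨0, by simp⟩
  add_mem' := fun {x y} hx hy => by
    obtain ⟨a, rfl⟩ := hx
    obtain ⟨c, rfl⟩ := hy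
    exact ⟨a + c, by rw [smul_add]⟩
  neg_mem' := fun {x} hx => by
    obtain ⟨a, rfl⟩ := hx
    exact ⟨-a, by simp⟩

/-- A `G`-equivariant homomorphism maps `Γ_G^s(A)` into `Γ_G^s(B)`. -/
theorem map_mem_gammaA {G A B : Type*} [Group G] [AddCommGroup A] [DistribMulAction G A]
    [AddCommGroup B] [DistribMulAction G B] (f : A →+ B)
    (hf : ∀ (g : G) (a : A), g • f a = f (g • a)) (s : ℕ) {x : A} (hx : x ∈ gammaA G A s) :
    f x ∈ gammaA G B s := by
  induction s generalizing x with
  | zero => exact AddSubgroup.mem_top _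
  | succ s ih =>
    suffices h : gammaA G A (s + 1) ≤ (gammaA G B (s + 1)).comap f from h hx
    refine (AddSubgroup.closure_le _).2 ?_
    rintro _ ⟨g, a, ha, rfl⟩
    exact AddSubgroup.subset_closure ⟨g, f a, ih ha, by rw [map_sub, hf]⟩

/-- If `Γ_G^m(A) ≤ kA`, then `Γ_G^{m+s}(A) ≤ k Γ_G^s(A)`. -/
theorem gammaA_add_le_map_nsmul {G A : Type*} [Group G] [AddCommGroup A] [DistribMulAction G A]
    {k m : ℕ} (h : gammaA G A m ≤ (⊤ : AddSubgroup A).map (nsmulAddMonoidHom k)) (s : ℕ) :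
    gammaA G A (m + s) ≤ (gammaA G A s).map (nsmulAddMonoidHom k) := by
  induction s with
  | zero => exact h
  | succ s ih =>
    refine (AddSubgroup.closure_le _).2 ?_
    rintro _ ⟨g, a, ha, rfl⟩
    obtain ⟨b, hb, rfl⟩ := ih ha
    refine ⟨b - g • b, AddSubgroup.subset_closure ⟨g, b, hb, rfl⟩, ?_⟩
    simp only [nsmulAddMonoidHom_apply]
    rw [nsmul_sub, smul_comm g k b]

/-- If `Γ_G^r(A) ≤ pA`, then `Γ_G^{kr}(A) ≤ p^k A`. -/
theorem gammaA_mul_le_map_pow_nsmul {G A : Type*} [Group G] [AddCommGroup A]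
    [DistribMulAction G A] {p r : ℕ} (h : gammaA G A r ≤ pMul p A) (k : ℕ) :
    gammaA G A (k * r) ≤ (⊤ : AddSubgroup A).map (nsmulAddMonoidHom (p ^ k)) := by
  induction k with
  | zero => exact fun x _ => ⟨x, AddSubgroup.mem_top x, by simp⟩
  | succ k ih =>
    intro x hx
    rw [Nat.succ_mul] at hx
    obtain ⟨b, hb, rfl⟩ := gammaA_add_le_map_nsmul ih r hx
    obtain ⟨c, rfl⟩ := h hb
    exact ⟨c, AddSubgroup.mem_top c, by simp [pow_succ, mul_nsmul']⟩

/-- Let `p` be a prime and `G` a group acting by automorphisms on an abelian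
`p`-group `A` of exponent dividing `pⁿ`. If `G` acts nilpotently on `A ⧸ pA` (via the induced
action) with `Γ_G^r(A ⧸ pA) = 0`, then `Γ_G^{n·r}(A) = 0`; in particular
`nil_G A ≤ n · nil_G (A ⧸ pA)`. -/
theorem gammaA_eq_bot_of_gammaA_mod_p_eq_bot
    {G A : Type*} [Group G] [AddCommGroup A] [DistribMulAction G A]
    (p n : ℕ) (hp : p.Prime) (hexp : ∀ a : A, p ^ n • a = 0)
    [instQ : DistribMulAction G (A ⧸ pMul p A)]
    (hcomp : ∀ (g : G) (a : A),
      g • (QuotientAddGroup.mk a : A ⧸ pMul p A) = QuotientAddGroup.mk (g • a))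
    (r : ℕ) (hr : gammaA G (A ⧸ pMul p A) r = ⊥) :
    gammaA G A (n * r) = ⊥ := by
  have h : gammaA G A r ≤ pMul p A := fun x hx => by
    have hmk := map_mem_gammaA (QuotientAddGroup.mk' (pMul p A)) hcomp r hx
    rw [hr] at hmk
    exact (QuotientAddGroup.eq_zero_iff x).1 hmk
  refine (AddSubgroup.eq_bot_iff_forall _).2 fun x hx => ?_
  obtain ⟨b, -, rfl⟩ := gammaA_mul_le_map_pow_nsmul h n hx
  exact hexp b
end

section
/- Let p be a prime, let P be a finite p-group acting by automorphisms on a finite p-group Q. Then the action is nilpotent: Γ_P^n(Q) = {1} for some n. -/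
open scoped commutatorElement in
/-- The `G`-commutator subgroups of `A` embed into the lower central series of `A ⋊ G`. -/
theorem gammaG_le_comap_lowerCentralSeries (G A : Type*) [Group G] [Group A]
    [MulDistribMulAction G A] (n : ℕ) :
    gammaG G A n ≤ ((⊤ : Subgroup (A ⋊[MulDistribMulAction.toMulAut G A] G)).lowerCentralSeries
      n).comap SemidirectProduct.inl := by
  induction n with
  | zero => exact fun _ _ => Subgroup.mem_top _
  | succ n ih =>
    rw [gammaG, Subgroup.closure_le]
    rintro _ ⟨g, a, ha, rfl⟩
    have hconj : (SemidirectProduct.inl (g • a) : A ⋊[MulDistribMulAction.toMulAut G A] G) =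
        SemidirectProduct.inr g * SemidirectProduct.inl a * SemidirectProduct.inr g⁻¹ :=
      SemidirectProduct.inl_aut g a
    have hcomm : (SemidirectProduct.inl ((g • a)⁻¹ * a) :
        A ⋊[MulDistribMulAction.toMulAut G A] G) =
        ⁅(SemidirectProduct.inr g : A ⋊[MulDistribMulAction.toMulAut G A] G),
          (SemidirectProduct.inl a)⁻¹⁆ := by
      rw [map_mul, map_inv, hconj, map_inv, commutatorElement_def]
      group
    rw [SetLike.mem_coe, Subgroup.mem_comap, hcomm, Subgroup.lowerCentralSeries_succ,
      Subgroup.commutator_comm]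
    exact Subgroup.commutator_mem_commutator (Subgroup.mem_top _) (inv_mem (ih ha))

/-- Let `p` be a prime and let a finite `p`-group `P` act by automorphisms on
a finite `p`-group `Q`. Then the action is nilpotent: `Γ_P^n(Q) = 1` for some `n`. -/
theorem pGroup_action_on_pGroup_nilpotent
    {P Q : Type*} [Group P] [Group Q] [Finite P] [Finite Q]
    (p : ℕ) (hp : p.Prime) (hP : IsPGroup p P) (hQ : IsPGroup p Q)
    [MulDistribMulAction P Q] :
    ∃ n, gammaG P Q n = ⊥ := by
  have : Fact p.Prime := ⟨hp⟩
  have hPQ : IsPGroup p (Q ⋊[MulDistribMulAction.toMulAut P Q] P) := by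
    obtain ⟨k, hk⟩ := IsPGroup.iff_card.mp hQ
    obtain ⟨l, hl⟩ := IsPGroup.iff_card.mp hP
    exact IsPGroup.of_card (n := k + l) (by rw [SemidirectProduct.card, hk, hl, pow_add])
  have : Finite (Q ⋊[MulDistribMulAction.toMulAut P Q] P) :=
    Finite.of_equiv _ SemidirectProduct.equivProd.symm
  obtain ⟨n, hn⟩ := Subgroup.nilpotent_iff_lowerCentralSeries.mp hPQ.isNilpotent
  refine ⟨n, le_bot_iff.mp ((gammaG_le_comap_lowerCentralSeries P Q n).trans ?_)⟩
  rw [hn, MonoidHom.comap_bot, (MonoidHom.ker_eq_bot_iff _).mpr SemidirectProduct.inl_injective]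
end
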